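/- arXiv:2505.10747 — 2 statements merged into one kernel-verified Lean document; each statement's English description precedes it below -/
import Mathlib

section
/- Fix s and for each N let F_N be a sub-σ-algebra of a probability space, let ē_N be an F_N-measurable random variable with ē_N ∈ [l_N, 1] almost surely, where l_N ∈ (0,1) satisfies N · l_N → ∞. Let (A_{uN}, Y_{uN}) for u = 1, …, N be pairs of random variables (A_{uN} ∈ {0,1}, Y_{uN} ∈ ℝ) that are conditionally i.i.d. given F_N and satisfy, for every measurable φ : ℝ → ℝ with E[|φ(Y_N^*)|] < ∞, E[1(A_{uN} = s) φ(Y_{uN}) | F_N] = ē_N · E[φ(Y_N^*)] almost surely, where Y_N^* is a reference real random variable satisfying sup_N E[(Y_N^*)⁴] < ∞ and sup_N |E[Y_N^*]| < ∞. Set μ_N = E[Y_N^*], m_N = E[(Y_N^*)²], and Λ̂_{uN} = 1(A_{uN} = s) Y_{uN} / ē_N. Then (ē_N / N) Σ_{u=1}^N (Λ̂_{uN} − μ_N)² − (m_N − ē_N μ_N²) → 0 in probability. -/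
open MeasureTheory Filter

/-- Conditional independence of a family `W` given a sub-σ-algebra `m`, phrased via the
product formula for bounded measurable test functions. -/
def CondIndepFam {Ω E ι : Type*} [MeasurableSpace E] (m : MeasurableSpace Ω)
    {mΩ : MeasurableSpace Ω} (P : Measure Ω) (W : ι → Ω → E) : Prop :=
  ∀ (s : Finset ι) (φ : ι → E → ℝ), (∀ i, Measurable (φ i)) →
    (∀ i, ∃ C, ∀ x, |φ i x| ≤ C) →
    (P[(fun ω => ∏ i ∈ s, φ i (W i ω)) | m]) =ᵐ[P]
      fun ω => ∏ i ∈ s, (P[(fun ω' => φ i (W i ω')) | m]) ω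

/-- The members of the family `W` are conditionally identically distributed given `m`. -/
def CondIdent {Ω E ι : Type*} [MeasurableSpace E] (m : MeasurableSpace Ω)
    {mΩ : MeasurableSpace Ω} (P : Measure Ω) (W : ι → Ω → E) : Prop :=
  ∀ (i j : ι) (φ : E → ℝ), Measurable φ → (∃ C, ∀ x, |φ x| ≤ C) →
    (P[(fun ω => φ (W i ω)) | m]) =ᵐ[P] (P[(fun ω => φ (W j ω)) | m])

/-- The family `W` is conditionally i.i.d. given `m`. -/
def CondIID {Ω E ι : Type*} [MeasurableSpace E] (m : MeasurableSpace Ω)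
    {mΩ : MeasurableSpace Ω} (P : Measure Ω) (W : ι → Ω → E) : Prop :=
  CondIndepFam m P W ∧ CondIdent m P W

/-- Replacing a factor by its conditional expectation inside an integral against a bounded
`m`-measurable weight. -/
theorem integral_mul_eq_of_condExp_ae_eq {Ω : Type*} {m m0 : MeasurableSpace Ω} (hm : m ≤ m0)
    (P : Measure Ω) [IsFiniteMeasure P] {h f f' : Ω → ℝ} (hh : Measurable[m] h) {c : ℝ}
    (hc : ∀ᵐ ω ∂P, ‖h ω‖ ≤ c) (hf : Integrable f P) (hf' : P[f | m] =ᵐ[P] f') :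
    ∫ ω, h ω * f ω ∂P = ∫ ω, h ω * f' ω ∂P := by
  have key := condExp_stronglyMeasurable_mul_of_bound hm hh.stronglyMeasurable hf c hc
  calc ∫ ω, h ω * f ω ∂P = ∫ ω, (P[h * f | m]) ω ∂P := (integral_condExp hm).symm
    _ = ∫ ω, h ω * f' ω ∂P := by
      refine integral_congr_ae ?_
      filter_upwards [key, hf'] with ω h1 h2
      simp [h1, h2]

/-- Second moment bound for the inverse-probability-weighted average of bounded variables that
are conditionally uncorrelated. -/
theorem integral_sq_average_le {Ω : Type*} {m m0 : MeasurableSpace Ω} (hm : m ≤ m0)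
    (P : Measure Ω) [IsProbabilityMeasure P] {N : ℕ} {l : ℝ} (hl : 0 < l)
    {e : Ω → ℝ} (he : Measurable[m] e) (hel : ∀ᵐ ω ∂P, l ≤ e ω)
    {G : Fin N → Ω → ℝ} (hG : ∀ u, Measurable (G u)) {C : ℝ} (hGC : ∀ u ω, |G u ω| ≤ C)
    {a b : ℝ} (hb : 0 ≤ b)
    (h1 : ∀ u, P[G u | m] =ᵐ[P] fun ω => e ω * a)
    (h2 : ∀ u, P[fun ω => G u ω * G u ω | m] =ᵐ[P] fun ω => e ω * b)
    (h12 : ∀ u v, u ≠ v →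
      P[fun ω => G u ω * G v ω | m] =ᵐ[P] fun ω => (e ω * a) * (e ω * a)) :
    ∫ ω, ((N : ℝ)⁻¹ * ∑ u, (G u ω / e ω - a)) ^ 2 ∂P ≤ b / (N * l) := by
  have heinv : ∀ᵐ ω ∂P, ‖(e ω)⁻¹‖ ≤ l⁻¹ := by
    filter_upwards [hel] with ω h
    rw [Real.norm_of_nonneg (inv_nonneg.2 (hl.le.trans h))]
    exact inv_anti₀ hl h
  have heinv2 : ∀ᵐ ω ∂P, ‖(e ω)⁻¹ ^ 2‖ ≤ l⁻¹ ^ 2 := by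
    filter_upwards [heinv] with ω h
    rw [norm_pow]
    gcongr
  have hGi : ∀ u, Integrable (G u) P := fun u =>
    Integrable.of_bound (hG u).aestronglyMeasurable C (.of_forall (hGC u))
  have hGGi : ∀ u v, Integrable (fun ω => G u ω * G v ω) P := fun u v =>
    (hGi v).bdd_mul (hG u).aestronglyMeasurable (.of_forall (hGC u))
  have hVi : ∀ u, Integrable (fun ω => (e ω)⁻¹ * G u ω) P := fun u =>
    (hGi u).bdd_mul (he.inv.mono hm le_rfl).aestronglyMeasurable heinv
  have hVVi : ∀ u v, Integrable (fun ω => (e ω)⁻¹ ^ 2 * (G u ω * G v ω)) P := fun u v =>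
    (hGGi u v).bdd_mul ((he.inv.pow_const 2).mono hm le_rfl).aestronglyMeasurable heinv2
  have hV : ∀ u, ∫ ω, (e ω)⁻¹ * G u ω ∂P = a := by
    intro u
    refine (integral_mul_eq_of_condExp_ae_eq hm P he.inv heinv (hGi u) (h1 u)).trans ?_
    calc ∫ ω, (e ω)⁻¹ * (e ω * a) ∂P = ∫ _, a ∂P := by
          refine integral_congr_ae ?_
          filter_upwards [hel] with ω h
          have : e ω ≠ 0 := (hl.trans_le h).ne'
          field_simp
      _ = a := by simp
  have hexp : ∀ u v ω, (G u ω / e ω - a) * (G v ω / e ω - a) =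
      (e ω)⁻¹ ^ 2 * (G u ω * G v ω) - a * ((e ω)⁻¹ * G u ω) - a * ((e ω)⁻¹ * G v ω) + a * a := by
    intro u v ω
    simp only [div_eq_mul_inv]
    ring
  have hci : ∀ u v, Integrable (fun ω => (G u ω / e ω - a) * (G v ω / e ω - a)) P := by
    intro u v
    simp only [hexp]
    exact (((hVVi u v).sub ((hVi u).const_mul a)).sub ((hVi v).const_mul a)).add
      (integrable_const _)
  have hcov : ∀ u v, ∫ ω, (G u ω / e ω - a) * (G v ω / e ω - a) ∂P =
      ∫ ω, (e ω)⁻¹ ^ 2 * (G u ω * G v ω) ∂P - a * a := by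
    intro u v
    simp only [hexp]
    have hi := (hVVi u v).sub ((hVi u).const_mul a)
    have hi' := hi.sub ((hVi v).const_mul a)
    simp only [Pi.sub_def] at hi hi'
    rw [integral_add hi' (integrable_const _), integral_sub hi ((hVi v).const_mul a),
      integral_sub (hVVi u v) ((hVi u).const_mul a), integral_const_mul, integral_const_mul,
      hV, hV]
    simp
  have hpull : ∀ u v f, P[fun ω => G u ω * G v ω | m] =ᵐ[P] f →
      ∫ ω, (e ω)⁻¹ ^ 2 * (G u ω * G v ω) ∂P = ∫ ω, (e ω)⁻¹ ^ 2 * f ω ∂P := fun u v _ hf =>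
    integral_mul_eq_of_condExp_ae_eq hm P (he.inv.pow_const 2) heinv2 (hGGi u v) hf
  have hoff : ∀ u v, u ≠ v → ∫ ω, (G u ω / e ω - a) * (G v ω / e ω - a) ∂P = 0 := by
    intro u v huv
    rw [hcov, hpull u v _ (h12 u v huv), sub_eq_zero]
    calc ∫ ω, (e ω)⁻¹ ^ 2 * ((e ω * a) * (e ω * a)) ∂P = ∫ _, a * a ∂P := by
          refine integral_congr_ae ?_
          filter_upwards [hel] with ω h
          have : e ω ≠ 0 := (hl.trans_le h).ne'
          field_simp
      _ = a * a := by simp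
  have hdiag : ∀ u, ∫ ω, (G u ω / e ω - a) * (G u ω / e ω - a) ∂P ≤ b / l := by
    intro u
    rw [hcov, hpull u u _ (h2 u)]
    have : ∫ ω, (e ω)⁻¹ ^ 2 * (e ω * b) ∂P ≤ ∫ _, b / l ∂P := by
      refine integral_mono_of_nonneg ?_ (integrable_const _) ?_
      · filter_upwards [hel] with ω h
        have : 0 < e ω := hl.trans_le h
        simp only [Pi.zero_apply]
        positivity
      · filter_upwards [hel] with ω h
        have : 0 < e ω := hl.trans_le h
        calc (e ω)⁻¹ ^ 2 * (e ω * b) = b / e ω := by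
              field_simp
          _ ≤ b / l := by gcongr
    simp only [integral_const, probReal_univ, one_smul] at this
    linarith [mul_self_nonneg a]
  have hsum : ∫ ω, (∑ u, (G u ω / e ω - a)) ^ 2 ∂P ≤ N * (b / l) := by
    simp only [sq, Finset.sum_mul_sum]
    rw [integral_finsetSum _ fun u _ => integrable_finsetSum _ fun v _ => hci u v]
    calc ∑ u, ∫ ω, ∑ v, (G u ω / e ω - a) * (G v ω / e ω - a) ∂P
        ≤ ∑ _u : Fin N, b / l := by
          refine Finset.sum_le_sum fun u _ => ?_
          rw [integral_finsetSum _ fun v _ => hci u v,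
            Finset.sum_eq_single u (fun v _ hv => hoff u v hv.symm) (by simp)]
          exact hdiag u
      _ = N * (b / l) := by simp
  simp only [mul_pow]
  rw [integral_const_mul]
  calc (N : ℝ)⁻¹ ^ 2 * ∫ ω, (∑ u, (G u ω / e ω - a)) ^ 2 ∂P
      ≤ (N : ℝ)⁻¹ ^ 2 * (N * (b / l)) := by gcongr
    _ = b / (N * l) := by
      rcases eq_or_ne (N : ℝ) 0 with h | h
      · simp [h]
      · field_simp

/-- An `L²` norm bound from a bound on the second moment. -/
theorem eLpNorm_two_le_of_integral_sq_le {Ω : Type*} {m0 : MeasurableSpace Ω} (P : Measure Ω)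
    {f : Ω → ℝ} (hf : MemLp f 2 P) {K : ℝ} (hK : ∫ ω, f ω ^ 2 ∂P ≤ K) :
    eLpNorm f 2 P ≤ ENNReal.ofReal √K := by
  rw [hf.eLpNorm_eq_integral_rpow_norm two_ne_zero ENNReal.ofNat_ne_top]
  refine ENNReal.ofReal_le_ofReal ?_
  rw [Real.sqrt_eq_rpow]
  simp only [ENNReal.toReal_ofNat, Real.rpow_two, Real.norm_eq_abs, sq_abs, one_div]
  exact Real.rpow_le_rpow (integral_nonneg fun _ => sq_nonneg _) hK (by norm_num)

/-- `L²` bound for the inverse-probability-weighted average of bounded functions of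
conditionally independent observations. -/
theorem eLpNorm_ipw_average_le_of_bounded {Ω : Type*} {m m0 : MeasurableSpace Ω} (hm : m ≤ m0)
    (P : Measure Ω) [IsProbabilityMeasure P] (s : Bool) {N : ℕ} {l : ℝ} (hl : 0 < l)
    {e : Ω → ℝ} (he : Measurable[m] e) (hel : ∀ᵐ ω ∂P, l ≤ e ω)
    {A : Fin N → Ω → Bool} {Y : Fin N → Ω → ℝ}
    (hA : ∀ u, Measurable (A u)) (hY : ∀ u, Measurable (Y u))
    (hind : CondIndepFam m P (fun u ω => (A u ω, Y u ω)))
    (ν : Measure ℝ) [IsProbabilityMeasure ν]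
    (hmix : ∀ (u : Fin N) (φ : ℝ → ℝ), Measurable φ → Integrable φ ν →
      (P[(fun ω => if A u ω = s then φ (Y u ω) else 0) | m]) =ᵐ[P]
        fun ω => e ω * ∫ x, φ x ∂ν)
    {g : ℝ → ℝ} (hg : Measurable g) {C : ℝ} (hC : ∀ x, |g x| ≤ C) :
    eLpNorm (fun ω => (N : ℝ)⁻¹ *
        ∑ u, ((if A u ω = s then g (Y u ω) else 0) / e ω - ∫ x, g x ∂ν)) 2 P ≤
      ENNReal.ofReal √((∫ x, g x ^ 2 ∂ν) / (N * l)) := by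
  have hC0 : 0 ≤ C := (abs_nonneg _).trans (hC 0)
  have hgi : Integrable g ν := Integrable.of_bound hg.aestronglyMeasurable C (.of_forall hC)
  have hg2i : Integrable (fun x => g x ^ 2) ν := by
    refine Integrable.of_bound (hg.pow_const 2).aestronglyMeasurable (C ^ 2) (.of_forall fun x => ?_)
    rw [norm_pow]
    exact pow_le_pow_left₀ (norm_nonneg _) (hC x) 2
  have hGm : ∀ u, Measurable (fun ω => if A u ω = s then g (Y u ω) else 0) := fun u =>
    Measurable.ite (hA u (measurableSet_singleton s)) (hg.comp (hY u)) measurable_const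
  have hGC : ∀ u ω, |if A u ω = s then g (Y u ω) else 0| ≤ C := by
    intro u ω
    split_ifs
    · exact hC _
    · simpa using hC0
  have hem : Measurable e := he.mono hm le_rfl
  refine eLpNorm_two_le_of_integral_sq_le P ?_ ?_
  · refine MemLp.of_bound (C := (N : ℝ)⁻¹ * ∑ _u : Fin N, (C * l⁻¹ + |∫ x, g x ∂ν|)) ?_ ?_
    · exact (measurable_const.mul (Finset.measurable_fun_sum _ fun u _ =>
        ((hGm u).div hem).sub measurable_const)).aestronglyMeasurable
    · filter_upwards [hel] with ω h
      rw [norm_mul, norm_inv, Real.norm_natCast]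
      gcongr
      refine norm_sum_le_of_le _ fun u _ => (norm_sub_le _ _).trans ?_
      rw [div_eq_mul_inv, norm_mul, norm_inv, Real.norm_of_nonneg (hl.le.trans h)]
      refine add_le_add (mul_le_mul (hGC u ω) (inv_anti₀ hl h) ?_ hC0) le_rfl
      exact inv_nonneg.2 (hl.le.trans h)
  · refine integral_sq_average_le hm P hl he hel hGm hGC (integral_nonneg fun _ => sq_nonneg _)
      (fun u => hmix u g hg hgi) (fun u => ?_) (fun u v huv => ?_)
    · refine EventuallyEq.trans (.of_eq ?_) (hmix u _ (hg.pow_const 2) hg2i)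
      congr 1
      ext ω
      split_ifs <;> ring
    · have := hind {u, v} (fun _ p => if p.1 = s then g p.2 else 0)
        (fun _ => Measurable.ite (measurable_fst (measurableSet_singleton s))
          (hg.comp measurable_snd) measurable_const)
        (fun _ => ⟨C, fun p => by
          split_ifs
          · exact hC _
          · simpa using hC0⟩)
      simp only [Finset.prod_pair huv] at this
      filter_upwards [this, hmix u g hg hgi, hmix v g hg hgi] with ω h h' h''
      rw [h, h', h'']

/-- `L²` bound for the inverse-probability-weighted average of square-integrable functions of
conditionally independent observations. -/
theorem eLpNorm_ipw_average_le {Ω : Type*} {m m0 : MeasurableSpace Ω} (hm : m ≤ m0)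
    (P : Measure Ω) [IsProbabilityMeasure P] (s : Bool) {N : ℕ} {l : ℝ} (hl : 0 < l)
    {e : Ω → ℝ} (he : Measurable[m] e) (hel : ∀ᵐ ω ∂P, l ≤ e ω)
    {A : Fin N → Ω → Bool} {Y : Fin N → Ω → ℝ}
    (hA : ∀ u, Measurable (A u)) (hY : ∀ u, Measurable (Y u))
    (hind : CondIndepFam m P (fun u ω => (A u ω, Y u ω)))
    (ν : Measure ℝ) [IsProbabilityMeasure ν]
    (hmix : ∀ (u : Fin N) (φ : ℝ → ℝ), Measurable φ → Integrable φ ν →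
      (P[(fun ω => if A u ω = s then φ (Y u ω) else 0) | m]) =ᵐ[P]
        fun ω => e ω * ∫ x, φ x ∂ν)
    {g : ℝ → ℝ} (hg : Measurable g) (hgL : MemLp g 2 ν) :
    eLpNorm (fun ω => (N : ℝ)⁻¹ *
        ∑ u, ((if A u ω = s then g (Y u ω) else 0) / e ω - ∫ x, g x ∂ν)) 2 P ≤
      ENNReal.ofReal √((∫ x, g x ^ 2 ∂ν) / (N * l)) := by
  set t : ℕ → ℝ → ℝ := fun k x => max (-(k : ℝ)) (min (g x) k) with ht
  have htm : ∀ k, Measurable (t k) := fun k =>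
    measurable_const.max (hg.min measurable_const)
  have htk : ∀ k x, |t k x| ≤ k := fun k x =>
    abs_le.2 ⟨le_max_left _ _, max_le (by linarith [k.cast_nonneg (α := ℝ)]) (min_le_right _ _)⟩
  have htg : ∀ k x, |t k x| ≤ |g x| := by
    intro k x
    have hk := k.cast_nonneg (α := ℝ)
    refine abs_le.2 ⟨?_, max_le (by linarith [abs_nonneg (g x)])
      ((min_le_left _ _).trans (le_abs_self _))⟩
    rcases le_total (g x) k with h | h
    · exact le_max_of_le_right (by rw [min_eq_left h]; exact neg_abs_le _)
    · exact le_max_of_le_right (by rw [min_eq_right h]; linarith [abs_nonneg (g x)])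
  have htlim : ∀ x, Tendsto (fun k => t k x) atTop (nhds (g x)) := by
    intro x
    refine tendsto_const_nhds.congr' ?_
    obtain ⟨K, hK⟩ := exists_nat_ge |g x|
    filter_upwards [eventually_ge_atTop K] with k hk
    have hk' : |g x| ≤ k := hK.trans (by exact_mod_cast hk)
    rw [ht]
    simp only
    rw [min_eq_left (abs_le.1 hk').2, max_eq_right (abs_le.1 hk').1]
  have hgi : Integrable g ν := hgL.integrable one_le_two
  have hint : Tendsto (fun k => ∫ x, t k x ∂ν) atTop (nhds (∫ x, g x ∂ν)) :=
    tendsto_integral_of_dominated_convergence (fun x => |g x|)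
      (fun k => (htm k).aestronglyMeasurable) hgi.abs (fun k => .of_forall (htg k))
      (.of_forall htlim)
  have hGm : ∀ k u, Measurable (fun ω => if A u ω = s then t k (Y u ω) else 0) := fun k u =>
    Measurable.ite (hA u (measurableSet_singleton s)) ((htm k).comp (hY u)) measurable_const
  have hem : Measurable e := he.mono hm le_rfl
  refine (Lp.eLpNorm_lim_le_liminf_eLpNorm (f := fun k ω => (N : ℝ)⁻¹ *
        ∑ u, ((if A u ω = s then t k (Y u ω) else 0) / e ω - ∫ x, t k x ∂ν)) (fun k => ?_) _
        (.of_forall fun ω => ?_)).trans ?_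
  · exact (measurable_const.mul (Finset.measurable_fun_sum _ fun u _ =>
      ((hGm k u).div hem).sub measurable_const)).aestronglyMeasurable
  · refine (tendsto_finsetSum _ fun u _ => (Tendsto.div_const ?_ _).sub hint).const_mul _
    split_ifs
    · exact htlim _
    · exact tendsto_const_nhds
  · refine liminf_le_of_le (by isBoundedDefault) fun c hc => ?_
    obtain ⟨k, hk⟩ := hc.exists
    refine hk.trans ((eLpNorm_ipw_average_le_of_bounded hm P s hl he hel hA hY hind ν hmix
      (htm k) (htk k)).trans (ENNReal.ofReal_le_ofReal (Real.sqrt_le_sqrt ?_)))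
    gcongr ?_ / _
    exact integral_mono_of_nonneg (.of_forall fun _ => sq_nonneg _) hgL.integrable_sq
      (.of_forall fun x => sq_le_sq.2 (htg k x))

/-- Conditional weak law for the empirical second moment of inverse probability
weighted observations: with assignment probability `ē_N ∈ [l_N, 1]` (`N l_N → ∞`),
conditionally i.i.d. data whose arm-`s` outcomes are distributed as the reference law
`ν_N` with bounded fourth moment and bounded mean, the normalized sum
`(ē_N/N) ∑_u (Λ̂_{uN} − μ_N)²` is asymptotically `m_N − ē_N μ_N²`, in probability. -/
theorem weak_law_ipw_second_moment
    {Ω : Type*} [m0 : MeasurableSpace Ω] (P : Measure Ω) [IsProbabilityMeasure P]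
    (s : Bool) (F : ℕ → MeasurableSpace Ω) (hF : ∀ N, F N ≤ m0)
    (l : ℕ → ℝ) (hl : ∀ N, l N ∈ Set.Ioo (0 : ℝ) 1)
    (hlN : Tendsto (fun N : ℕ => (N : ℝ) * l N) atTop atTop)
    (ebar : ℕ → Ω → ℝ) (hem : ∀ N, Measurable[F N] (ebar N))
    (hebar : ∀ N, ∀ᵐ ω ∂P, ebar N ω ∈ Set.Icc (l N) 1)
    (A : (N : ℕ) → Fin N → Ω → Bool) (Y : (N : ℕ) → Fin N → Ω → ℝ)
    (hAm : ∀ N u, Measurable (A N u)) (hYm : ∀ N u, Measurable (Y N u))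
    (hiid : ∀ N, CondIID (F N) P (fun u : Fin N => fun ω => (A N u ω, Y N u ω)))
    (ν : ℕ → Measure ℝ) (hνprob : ∀ N, IsProbabilityMeasure (ν N))
    (hν4 : ∀ N, Integrable (fun x => x ^ 4) (ν N))
    (C4 : ℝ) (hC4 : ∀ N, (∫ x, x ^ 4 ∂ν N) ≤ C4)
    (C1 : ℝ) (hC1 : ∀ N, |∫ x, x ∂ν N| ≤ C1)
    (hmix : ∀ N (u : Fin N) (φ : ℝ → ℝ), Measurable φ → Integrable φ (ν N) →
      (P[(fun ω => if A N u ω = s then φ (Y N u ω) else 0) | F N]) =ᵐ[P]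
        fun ω => ebar N ω * ∫ x, φ x ∂ν N) :
    TendstoInMeasure P
      (fun N ω =>
        ebar N ω / N *
            (∑ u : Fin N,
              ((if A N u ω = s then Y N u ω else 0) / ebar N ω - ∫ x, x ∂ν N) ^ 2) -
          ((∫ x, x ^ 2 ∂ν N) - ebar N ω * (∫ x, x ∂ν N) ^ 2))
      atTop 0 := by
  have hid2 : ∀ N, Integrable (fun x : ℝ => x ^ 2) (ν N) := fun N =>
    ((integrable_const (1 : ℝ)).add (hν4 N)).mono'
      (measurable_id.pow_const 2).aestronglyMeasurable (.of_forall fun x => by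
        simp only [Pi.add_apply, norm_pow, Real.norm_eq_abs, sq_abs]
        nlinarith [sq_nonneg (x ^ 2 - 1), sq_nonneg (x ^ 2)])
  have hid : ∀ N, MemLp (fun x : ℝ => x) 2 (ν N) := fun N =>
    (memLp_two_iff_integrable_sq measurable_id.aestronglyMeasurable).2 (hid2 N)
  have hsq : ∀ N, MemLp (fun x : ℝ => x ^ 2) 2 (ν N) := fun N =>
    (memLp_two_iff_integrable_sq (measurable_id.pow_const 2).aestronglyMeasurable).2 <|
      (hν4 N).congr (.of_forall fun x => by simp only [id]; ring)
  have hm2 : ∀ N, ∫ x, x ^ 2 ∂ν N ≤ 1 + C4 := by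
    intro N
    calc ∫ x, x ^ 2 ∂ν N ≤ ∫ x, (1 + x ^ 4) ∂ν N :=
          integral_mono (hid2 N) ((integrable_const _).add (hν4 N)) fun x => by
            simp only
            nlinarith [sq_nonneg (x ^ 2 - 1), sq_nonneg (x ^ 2)]
      _ = 1 + ∫ x, x ^ 4 ∂ν N := by
          rw [integral_add (integrable_const _) (hν4 N)]
          simp
      _ ≤ 1 + C4 := by linarith [hC4 N]
  have hXm : ∀ N u (φ : ℝ → ℝ), Measurable φ →
      Measurable (fun ω => if A N u ω = s then φ (Y N u ω) else 0) := fun N u φ hφ =>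
    Measurable.ite (hAm N u (measurableSet_singleton s)) (hφ.comp (hYm N u)) measurable_const
  have hem0 : ∀ N, Measurable (ebar N) := fun N => (hem N).mono (hF N) le_rfl
  set Q : (ℝ → ℝ) → ℕ → Ω → ℝ := fun φ N ω => (N : ℝ)⁻¹ *
    ∑ u, ((if A N u ω = s then φ (Y N u ω) else 0) / ebar N ω - ∫ x, φ x ∂ν N) with hQ
  have hQm : ∀ φ, Measurable φ → ∀ N, Measurable (Q φ N) := fun φ hφ N =>
    measurable_const.mul (Finset.measurable_fun_sum _ fun u _ =>
      ((hXm N u φ hφ).div (hem0 N)).sub measurable_const)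
  have hQlim : ∀ φ : ℝ → ℝ, Measurable φ → (∀ N, MemLp φ 2 (ν N)) → ∀ K,
      (∀ N, ∫ x, φ x ^ 2 ∂ν N ≤ K) →
      Tendsto (fun N => eLpNorm (Q φ N) 2 P) atTop (nhds 0) := by
    intro φ hφ hφL K hK
    have hlim : Tendsto (fun N : ℕ => ENNReal.ofReal √(K / (N * l N))) atTop (nhds 0) := by
      have := (ENNReal.continuous_ofReal.comp Real.continuous_sqrt).tendsto 0
      simp only [Function.comp_apply, Real.sqrt_zero, ENNReal.ofReal_zero] at this
      exact this.comp (hlN.const_div_atTop K)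
    refine tendsto_of_tendsto_of_tendsto_of_le_of_le tendsto_const_nhds hlim
      (fun _ => zero_le) fun N => ?_
    refine (eLpNorm_ipw_average_le (hF N) P s (hl N).1 (hem N) ((hebar N).mono fun _ h => h.1)
      (hAm N) (hYm N) (hiid N).1 (ν N) (hmix N) hφ (hφL N)).trans
      (ENNReal.ofReal_le_ofReal (Real.sqrt_le_sqrt ?_))
    have := (hl N).1
    gcongr
    exact hK N
  have hQ1 := hQlim (fun x => x) measurable_id hid (1 + C4) hm2
  have hQ2 := hQlim (fun x => x ^ 2) (measurable_id.pow_const 2) hsq C4 fun N => by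
    simpa only [← pow_mul] using hC4 N
  have hdecomp : ∀ N : ℕ, N ≠ 0 → ∀ᵐ ω ∂P,
      ebar N ω / N *
            (∑ u : Fin N,
              ((if A N u ω = s then Y N u ω else 0) / ebar N ω - ∫ x, x ∂ν N) ^ 2) -
          ((∫ x, x ^ 2 ∂ν N) - ebar N ω * (∫ x, x ∂ν N) ^ 2) =
        Q (fun x => x ^ 2) N ω + (-2 * (∫ x, x ∂ν N) * ebar N ω) * Q (fun x => x) N ω := by
    intro N hN
    have hN' : (N : ℝ) ≠ 0 := Nat.cast_ne_zero.2 hN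
    filter_upwards [hebar N] with ω hω
    have he : ebar N ω ≠ 0 := ((hl N).1.trans_le hω.1).ne'
    have hconst : (∫ x, x ^ 2 ∂ν N) - ebar N ω * (∫ x, x ∂ν N) ^ 2 =
        ∑ _u : Fin N, (N : ℝ)⁻¹ * ((∫ x, x ^ 2 ∂ν N) - ebar N ω * (∫ x, x ∂ν N) ^ 2) := by
      rw [Finset.sum_const, Finset.card_univ, Fintype.card_fin, nsmul_eq_mul]
      field_simp
    rw [hconst]
    simp only [hQ, Finset.mul_sum]
    rw [← Finset.sum_sub_distrib, ← Finset.sum_add_distrib]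
    refine Finset.sum_congr rfl fun u _ => ?_
    split_ifs <;> field_simp <;> ring
  have hbound : ∀ᶠ N in atTop, eLpNorm (fun ω =>
        ebar N ω / N *
            (∑ u : Fin N,
              ((if A N u ω = s then Y N u ω else 0) / ebar N ω - ∫ x, x ∂ν N) ^ 2) -
          ((∫ x, x ^ 2 ∂ν N) - ebar N ω * (∫ x, x ∂ν N) ^ 2)) 2 P ≤
      eLpNorm (Q (fun x => x ^ 2) N) 2 P +
        ENNReal.ofReal (2 * C1) * eLpNorm (Q (fun x => x) N) 2 P := by
    filter_upwards [eventually_ne_atTop 0] with N hN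
    rw [eLpNorm_congr_ae (hdecomp N hN)]
    refine (eLpNorm_add_le (hQm _ (measurable_id.pow_const 2) N).aestronglyMeasurable
      ((measurable_const.mul (hem0 N)).mul (hQm _ measurable_id N)).aestronglyMeasurable
      one_le_two).trans ?_
    refine add_le_add le_rfl (eLpNorm_le_mul_eLpNorm_of_ae_le_mul ?_ 2)
    filter_upwards [hebar N] with ω hω
    have he : 0 ≤ ebar N ω := (hl N).1.le.trans hω.1
    have hc : ‖-2 * (∫ x, x ∂ν N) * ebar N ω‖ ≤ 2 * C1 := by
      rw [norm_mul, norm_mul, norm_neg, Real.norm_of_nonneg he, Real.norm_ofNat,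
        Real.norm_eq_abs]
      nlinarith [hω.2, hC1 N, abs_nonneg (∫ x, x ∂ν N)]
    exact (norm_mul _ _).trans_le (mul_le_mul_of_nonneg_right hc (norm_nonneg _))
  refine tendstoInMeasure_of_tendsto_eLpNorm two_ne_zero (fun N => ?_)
    aestronglyMeasurable_zero ?_
  · exact (((hem0 N).div_const _).mul (Finset.measurable_fun_sum _ fun u _ =>
      (((hXm N u _ measurable_id).div (hem0 N)).sub measurable_const).pow_const 2)).sub
      (measurable_const.sub ((hem0 N).mul_const _)) |>.aestronglyMeasurable
  · simp only [sub_zero]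
    refine tendsto_of_tendsto_of_tendsto_of_le_of_le' tendsto_const_nhds ?_
      (.of_forall fun _ => zero_le) hbound
    have hlim := hQ2.add
      (ENNReal.Tendsto.const_mul (a := ENNReal.ofReal (2 * C1)) hQ1 (.inr ENNReal.ofReal_ne_top))
    rwa [mul_zero, add_zero] at hlim
end

section
/- Fix s and for each N let F_N be a sub-σ-algebra of a probability space, let ē_N be an F_N-measurable random variable with ē_N ∈ (0, 1] almost surely, and let (A_{uN}, Y_{uN}) for u = 1, …, N be pairs of random variables (A_{uN} ∈ {0,1}, Y_{uN} ∈ ℝ) that are conditionally i.i.d. given F_N and satisfy, for every measurable φ : ℝ → ℝ with E[|φ(Y_N^*)|] < ∞, E[1(A_{uN} = s) φ(Y_{uN}) | F_N] = ē_N · E[φ(Y_N^*)] almost surely, where Y_N^* is a reference real random variable with sup_N E[(Y_N^*)²] < ∞. Set μ_N = E[Y_N^*] and Λ̂_{uN} = 1(A_{uN} = s) Y_{uN} / ē_N. Suppose additionally that: (1) M_N is a sequence of random variables with M_N − μ_N → 0 in probability; and (2) there exists δ > 0 such that P[(ē_N/N) Σ_{u=1}^N (Λ̂_{uN} − μ_N)²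 ≥ δ] → 1. Then the ratio Σ_{u=1}^N (Λ̂_{uN} − M_N)² / Σ_{u=1}^N (Λ̂_{uN} − μ_N)² → 1 in probability. -/
open MeasureTheory Filter

/-- Shifting every term of a sum of squares by a small `d` changes the sum by a small relative
amount, provided the sum of squares is at least `δ` times the number of terms. -/
theorem abs_sum_sub_sq_div_sum_sq_sub_one_le {ι : Type*} [Fintype ι] [Nonempty ι] (x : ι → ℝ)
    {d δ t : ℝ} (hδ : 0 < δ) (ht : 0 ≤ t) (hd : d ^ 2 ≤ δ * t ^ 2)
    (hx : δ * Fintype.card ι ≤ ∑ u, x u ^ 2) :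
    |(∑ u, (x u - d) ^ 2) / (∑ u, x u ^ 2) - 1| ≤ 2 * t + t ^ 2 := by
  set n : ℝ := (Fintype.card ι : ℝ) with hn
  set D := ∑ u, x u ^ 2 with hD
  have hn0 : 0 < n := by simp [hn, Fintype.card_pos]
  have hD0 : 0 < D := (mul_pos hδ hn0).trans_le hx
  have hexp : ∑ u, (x u - d) ^ 2 = D - 2 * (d * ∑ u, x u) + n * d ^ 2 := by
    simp only [sub_sq, Finset.sum_add_distrib, Finset.sum_sub_distrib, Finset.sum_const,
      Finset.card_univ, nsmul_eq_mul, ← Finset.sum_mul, ← Finset.mul_sum, hn, hD]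
    ring
  have hcs : (∑ u, x u) ^ 2 ≤ n * D := by
    simpa [hn, hD] using sq_sum_le_card_mul_sum_sq (s := Finset.univ) (f := x)
  have hnd : n * d ^ 2 ≤ t ^ 2 * D := by
    calc n * d ^ 2 ≤ n * (δ * t ^ 2) := by gcongr
      _ = t ^ 2 * (δ * n) := by ring
      _ ≤ t ^ 2 * D := by gcongr
  have hcross : |d * ∑ u, x u| ≤ t * D := by
    refine abs_le_of_sq_le_sq ?_ (by positivity)
    calc (d * ∑ u, x u) ^ 2 = d ^ 2 * (∑ u, x u) ^ 2 := by ring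
      _ ≤ d ^ 2 * (n * D) := by gcongr
      _ = n * d ^ 2 * D := by ring
      _ ≤ t ^ 2 * D * D := by gcongr
      _ = (t * D) ^ 2 := by ring
  rw [div_sub_one hD0.ne', abs_div, abs_of_pos hD0, div_le_iff₀ hD0, hexp]
  have hnd0 : 0 ≤ n * d ^ 2 := by positivity
  rw [abs_le] at hcross ⊢
  constructor <;> nlinarith [hcross.1, hcross.2, mul_nonneg (sq_nonneg t) hD0.le]

/-- Self-normalized consistency of the centering: replacing the true mean `μ_N` by any
consistent estimate `M_N` does not change the empirical sum of squares of the IPW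
observations, to first order: the ratio
`∑_u (Λ̂_{uN} − M_N)² / ∑_u (Λ̂_{uN} − μ_N)²` tends to `1` in probability, provided the
normalized denominator is stochastically bounded away from zero. -/
theorem ratio_sum_sq_centered_tendsto_one
    {Ω : Type*} [m0 : MeasurableSpace Ω] (P : Measure Ω) [IsProbabilityMeasure P]
    (s : Bool) (F : ℕ → MeasurableSpace Ω) (hF : ∀ N, F N ≤ m0)
    (ebar : ℕ → Ω → ℝ) (hem : ∀ N, Measurable[F N] (ebar N))
    (hebar : ∀ N, ∀ᵐ ω ∂P, ebar N ω ∈ Set.Ioc (0 : ℝ) 1)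
    (A : (N : ℕ) → Fin N → Ω → Bool) (Y : (N : ℕ) → Fin N → Ω → ℝ)
    (hAm : ∀ N u, Measurable (A N u)) (hYm : ∀ N u, Measurable (Y N u))
    (hiid : ∀ N, CondIID (F N) P (fun u : Fin N => fun ω => (A N u ω, Y N u ω)))
    (ν : ℕ → Measure ℝ) (hνprob : ∀ N, IsProbabilityMeasure (ν N))
    (hν2 : ∀ N, Integrable (fun x => x ^ 2) (ν N))
    (C2 : ℝ) (hC2 : ∀ N, (∫ x, x ^ 2 ∂ν N) ≤ C2)
    (hmix : ∀ N (u : Fin N) (φ : ℝ → ℝ), Measurable φ → Integrable φ (ν N) →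
      (P[(fun ω => if A N u ω = s then φ (Y N u ω) else 0) | F N]) =ᵐ[P]
        fun ω => ebar N ω * ∫ x, φ x ∂ν N)
    (M : ℕ → Ω → ℝ) (hMm : ∀ N, AEMeasurable (M N) P)
    (hM : TendstoInMeasure P (fun N ω => M N ω - ∫ x, x ∂ν N) atTop 0)
    (δ : ℝ) (hδ : 0 < δ)
    (hden : Tendsto
      (fun N => P {ω | δ ≤ ebar N ω / N *
        ∑ u : Fin N,
          ((if A N u ω = s then Y N u ω else 0) / ebar N ω - ∫ x, x ∂ν N) ^ 2})
      atTop (nhds 1)) :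
    TendstoInMeasure P
      (fun N ω =>
        (∑ u : Fin N,
            ((if A N u ω = s then Y N u ω else 0) / ebar N ω - M N ω) ^ 2) /
          ∑ u : Fin N,
            ((if A N u ω = s then Y N u ω else 0) / ebar N ω - ∫ x, x ∂ν N) ^ 2)
      atTop (fun _ => (1 : ℝ)) := by
  rw [tendstoInMeasure_iff_norm] at hM ⊢
  intro ε hε
  set E : ℕ → Set Ω := fun N => {ω | δ ≤ ebar N ω / N *
    ∑ u : Fin N,
      ((if A N u ω = s then Y N u ω else 0) / ebar N ω - ∫ x, x ∂ν N) ^ 2} with hE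
  have hEm : ∀ N, MeasurableSet (E N) := by
    intro N
    have he : Measurable (ebar N) := (hem N).mono (hF N) le_rfl
    refine measurableSet_le measurable_const ((he.div_const _).mul ?_)
    refine Finset.measurable_sum _ fun u _ => ?_
    exact ((((hYm N u).ite (hAm N u (measurableSet_singleton s)) measurable_const).div
      he).sub_const _).pow_const 2
  have hEc : Tendsto (fun N => P (E N)ᶜ) atTop (nhds 0) := by
    simpa [prob_compl_eq_one_sub (hEm _)] using
      ENNReal.Tendsto.sub (tendsto_const_nhds (x := (1 : ENNReal))) hden (by simp)
  set t : ℝ := min 1 (ε / 4) with ht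
  have ht0 : 0 < t := lt_min one_pos (by positivity)
  have htε : 2 * t + t ^ 2 < ε := by
    nlinarith [min_le_left (1 : ℝ) (ε / 4), min_le_right (1 : ℝ) (ε / 4)]
  have hη : 0 < √δ * t := by positivity
  have hsum := hEc.add (hM _ hη)
  rw [add_zero] at hsum
  refine tendsto_of_tendsto_of_tendsto_of_le_of_le tendsto_const_nhds hsum
    (fun _ => zero_le) fun N => ?_
  refine (measure_mono_ae ?_).trans (measure_union_le _ _)
  filter_upwards [hebar N] with ω hω hbad
  by_contra hgood
  have hgood' : ω ∈ E N ∧ |M N ω - ∫ x, x ∂ν N| < √δ * t := by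
    have h : ¬ (ω ∈ (E N)ᶜ ∪ {x | √δ * t ≤ ‖M N x - ∫ x, x ∂ν N - (0 : Ω → ℝ) x‖}) := hgood
    simpa [Set.mem_union, not_or] using h
  obtain ⟨hωE, hd⟩ := hgood'
  rcases N.eq_zero_or_pos with rfl | hN
  · simp only [hE, Set.mem_setOf_eq, Finset.univ_eq_empty, Finset.sum_empty, mul_zero] at hωE
    linarith
  have : Nonempty (Fin N) := ⟨⟨0, hN⟩⟩
  have hN' : (0 : ℝ) < N := by exact_mod_cast hN
  set x : Fin N → ℝ := fun u =>
    (if A N u ω = s then Y N u ω else 0) / ebar N ω - ∫ x, x ∂ν N with hx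
  have hlow : δ * Fintype.card (Fin N) ≤ ∑ u, x u ^ 2 := by
    rw [Fintype.card_fin, ← le_div_iff₀ hN']
    have hD : (0 : ℝ) ≤ (∑ u, x u ^ 2) / N := by positivity
    calc δ ≤ ebar N ω / N * ∑ u, x u ^ 2 := hωE
      _ = ebar N ω * ((∑ u, x u ^ 2) / N) := by ring
      _ ≤ (∑ u, x u ^ 2) / N := mul_le_of_le_one_left hD hω.2
  have hd2 : (M N ω - ∫ x, x ∂ν N) ^ 2 ≤ δ * t ^ 2 := by
    calc (M N ω - ∫ x, x ∂ν N) ^ 2 ≤ (√δ * t) ^ 2 :=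
          sq_le_sq' (abs_lt.mp hd).1.le (abs_lt.mp hd).2.le
      _ = δ * t ^ 2 := by rw [mul_pow, Real.sq_sqrt hδ.le]
  have key := abs_sum_sub_sq_div_sum_sq_sub_one_le x hδ ht0.le hd2 hlow
  simp only [hx, sub_sub_sub_cancel_right] at key
  exact (key.trans_lt htε).not_ge hbad
end
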